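/- Consider the causal model M = ({X,Y}, E₀, f₀, X→Y) where X and Y each take n values, Y = f₀(X,E₀), E₀ is independent of X, f₀ is generic, the support of E₀ has cardinality θ < n(n−1), and the distributions of X and E₀ are sampled uniformly and independently from the (n−1)- and (θ−1)-dimensional probability simplices. Then with probability 1: the minimum cardinality of the support of a variable E independent of X admitting a deterministic f with Y = f(X,E) is strictly smaller than the minimum cardinality of the support of a variable Ẽ independent of Y admitting a deterministic g with X = g(Y,Ẽ). Hence comparing these minimum cardinalities identifies the true causal direction. -/

import Mathlib

open MeasureTheory

/-- `(pE, f)` is a causal model in direction `X → Y` for the joint distribution `p`: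
`pE` is the distribution of a finite exogenous variable `E` independent of `X`,
and `Y = f(X, E)`, so that `p x y = P(X = x) · P(f(x, E) = y)`. -/
def IsCausalModel {α β γ : Type*} [Fintype α] [Fintype β] [Fintype γ] [DecidableEq β]
    (p : α → β → ℝ) (pE : γ → ℝ) (f : α → γ → β) : Prop :=
  (∀ e, 0 ≤ pE e) ∧ (∑ e, pE e = 1) ∧
    ∀ x y, p x y = (∑ y', p x y') * ∑ e, if f x e = y then pE e else 0

/-- A function `f` with `Y = f(X,E)` is generic if for every `x₁ ≠ x₂` and every `y` the
inverse maps `f_{x₁}⁻¹(y) = {e : f x₁ e = y}` and `f_{x₂}⁻¹(y)` differ, and every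
`f_x⁻¹(y)` is nonempty. -/
def Generic {n θ m : ℕ} (f : Fin n → Fin θ → Fin m) : Prop :=
  (∀ x₁ x₂ y, x₁ ≠ x₂ → {e | f x₁ e = y} ≠ {e | f x₂ e = y}) ∧
  (∀ x y, ∃ e, f x e = y)

/-- The joint distribution of `(X, Y)` induced by `X ∼ pX`, `E ∼ pE` with `E ⟂ X`,
and `Y = f(X, E)`. -/
noncomputable def jointOf {n θ m : ℕ} (pX : Fin n → ℝ) (pE : Fin θ → ℝ)
    (f : Fin n → Fin θ → Fin m) (x : Fin n) (y : Fin m) : ℝ :=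
  pX x * ∑ e, if f x e = y then pE e else 0

/-- The minimum, over all causal models `(pE, f)` in direction `α → β` inducing the joint
distribution `p`, of the cardinality of the support of the exogenous variable. -/
noncomputable def minExogenousSupportCard {α β : Type*}
    [Fintype α] [Fintype β] [DecidableEq β] (p : α → β → ℝ) : ℕ :=
  sInf {c : ℕ | ∃ (m : ℕ) (pE : Fin m → ℝ) (f : α → Fin m → β),
    IsCausalModel p pE f ∧ (Finset.univ.filter fun e => pE e ≠ 0).card = c}

/-- The uniform probability measure on the `(k-1)`-dimensional probability simplex:
the `(k-1)`-dimensional Hausdorff measure restricted to the simplex, normalized. -/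
noncomputable def uniformSimplex (k : ℕ) : Measure (Fin k → ℝ) :=
  (μH[(k : ℝ) - 1] (stdSimplex ℝ (Fin k)))⁻¹ •
    (μH[(k : ℝ) - 1]).restrict (stdSimplex ℝ (Fin k))

open MvPolynomial

/-- A nonzero real polynomial is nonzero almost everywhere. -/
theorem ae_eval_ne_zero {k : ℕ} {P : MvPolynomial (Fin k) ℝ} (hP : P ≠ 0) :
    ∀ᵐ v : Fin k → ℝ, eval v P ≠ 0 := by
  induction k with
  | zero =>
    refine Filter.Eventually.of_forall fun v hv => hP (MvPolynomial.funext fun w => ?_)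
    rw [Subsingleton.elim w v, hv, map_zero]
  | succ k ih =>
    have hlead : (finSuccEquiv ℝ k P).leadingCoeff ≠ 0 := by simpa using hP
    have hmeas : MeasurableSet
        {z : ℝ × (Fin k → ℝ) | eval (Fin.cons z.1 z.2 : Fin (k + 1) → ℝ) P ≠ 0} := by
      refine (IsClosed.measurableSet ?_).compl
      refine isClosed_singleton.preimage ((MvPolynomial.continuous_eval P).comp ?_)
      exact Continuous.finCons continuous_fst continuous_snd
    have key : ∀ᵐ z : ℝ × (Fin k → ℝ), eval (Fin.cons z.1 z.2 : Fin (k + 1) → ℝ) P ≠ 0 := by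
      rw [Measure.volume_eq_prod, Measure.ae_prod_iff_ae_ae hmeas, Measure.ae_ae_comm hmeas]
      filter_upwards [ih hlead] with s hs
      have hmap : Polynomial.map (eval s) (finSuccEquiv ℝ k P) ≠ 0 := fun h => hs <| by
        simpa [Polynomial.coeff_map] using
          congrArg (fun q => q.coeff (finSuccEquiv ℝ k P).natDegree) h
      have hfin : Set.Finite
          {y : ℝ | (Polynomial.map (eval s) (finSuccEquiv ℝ k P)).IsRoot y} :=
        Polynomial.finite_setOfPred_isRoot hmap
      filter_upwards [compl_mem_ae_iff.2 (hfin.measure_zero volume)] with y hy h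
      exact hy (by rwa [eval_eq_eval_mv_eval'] at h)
    have := (volume_preserving_piFinSuccAbove (fun _ : Fin (k + 1) => ℝ)
      0).quasiMeasurePreserving.ae key
    filter_upwards [this] with v hv
    convert hv
    exact (Fin.cons_self_tail v).symm

/-- The `(k-1)`-dimensional simplex, parametrised by all its coordinates but the first. -/
def simplexChart {k : ℕ} (t : Fin k → ℝ) : Fin (k + 1) → ℝ :=
  Fin.cons (1 - ∑ i, t i) t

theorem exists_lipschitzWith_simplexChart (k : ℕ) :
    ∃ K, LipschitzWith K (simplexChart : (Fin k → ℝ) → Fin (k + 1) → ℝ) := by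
  refine ⟨k + 1, LipschitzWith.of_dist_le_mul fun s t => ?_⟩
  rw [dist_pi_le_iff (by positivity)]
  intro i
  have h0 : ∀ i, dist (s i) (t i) ≤ dist s t := dist_le_pi_dist s t
  refine Fin.cases ?_ (fun j => ?_) i
  · have : dist (∑ i, s i) (∑ i, t i) ≤ k * dist s t := by
      refine (dist_sum_sum_le _ _ _).trans ?_
      simpa using Finset.sum_le_card_nsmul Finset.univ _ _ fun i _ => h0 i
    simp only [simplexChart, Fin.cons_zero, dist_sub_left]
    push_cast
    nlinarith [dist_nonneg (x := s) (y := t)]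
  · simp only [simplexChart, Fin.cons_succ]
    push_cast
    nlinarith [dist_nonneg (x := s) (y := t), h0 j, mul_nonneg (Nat.cast_nonneg (α := ℝ) k)
      (dist_nonneg (x := s) (y := t))]

instance (k : ℕ) : IsFiniteMeasure (uniformSimplex k) := by
  refine ⟨?_⟩
  simp only [uniformSimplex, Measure.smul_apply, Measure.restrict_apply_univ, smul_eq_mul]
  exact ENNReal.inv_mul_le_one _ |>.trans_lt ENNReal.one_lt_top

theorem ae_uniformSimplex_mem (k : ℕ) : ∀ᵐ w ∂uniformSimplex k, w ∈ stdSimplex ℝ (Fin k) :=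
  Measure.ae_smul_measure (ae_restrict_mem (isClosed_stdSimplex ℝ (Fin k)).measurableSet) _

/-- A nonzero form is nonzero almost everywhere on the simplex. -/
theorem ae_uniformSimplex_eval_ne_zero {k d : ℕ} (hk : 0 < k) {P : MvPolynomial (Fin k) ℝ}
    (hP : P ≠ 0) (hom : ∀ (t : ℝ) v, eval (t • v) P = t ^ d * eval v P) :
    ∀ᵐ w ∂uniformSimplex k, eval w P ≠ 0 := by
  obtain ⟨k, rfl⟩ := Nat.exists_eq_succ_of_ne_zero hk.ne'
  set Q : MvPolynomial (Fin k) ℝ :=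
    bind₁ (Fin.cons (1 - ∑ i, X i) X : Fin (k + 1) → MvPolynomial (Fin k) ℝ) P with hQdef
  have hQ : ∀ t, eval t Q = eval (simplexChart t) P := fun t => by
    rw [hQdef, eval, eval₂Hom_bind₁]
    congr 2
    funext i
    refine Fin.cases ?_ (fun j => ?_) i <;> simp [simplexChart]
  have hchart : ∀ v : Fin (k + 1) → ℝ, ∑ i, v i = 1 → simplexChart (Fin.tail v) = v := by
    intro v hv
    rw [Fin.sum_univ_succ] at hv
    conv_rhs => rw [← Fin.cons_self_tail v]
    simp only [simplexChart, Fin.tail]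
    rw [← hv]
    congr 1
    ring
  have hQ0 : Q ≠ 0 := by
    intro h
    have hprod : P * ∑ i, X i = 0 := by
      refine MvPolynomial.funext fun v => ?_
      by_cases hs : ∑ i, v i = 0
      · simp [hs]
      · have h1 : eval ((∑ i, v i)⁻¹ • v) P = 0 := by
          rw [← hchart ((∑ i, v i)⁻¹ • v), ← hQ, h, map_zero]
          simp [← Finset.mul_sum, hs]
        rw [hom] at h1
        have : eval v P = 0 := by simpa [hs] using h1
        simp [this]
    rcases mul_eq_zero.1 hprod with h | h
    · exact hP h
    · simpa [Fin.sum_univ_succ] using congrArg (eval (Fin.cons 1 0 : Fin (k + 1) → ℝ)) h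
  obtain ⟨K, hK⟩ := exists_lipschitzWith_simplexChart k
  have hnull : μH[((k + 1 : ℕ) : ℝ) - 1] (simplexChart '' {t : Fin k → ℝ | eval t Q = 0}) = 0 := by
    have hdim : ((k + 1 : ℕ) : ℝ) - 1 = (Fintype.card (Fin k) : ℕ) := by simp
    rw [hdim]
    refine le_antisymm ((hK.hausdorffMeasure_image_le (Nat.cast_nonneg _) _).trans ?_) zero_le
    rw [hausdorffMeasure_pi_real]
    have : volume {t : Fin k → ℝ | eval t Q = 0} = 0 := by
      simpa [ae_iff] using ae_eval_ne_zero hQ0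
    simp [this]
  refine Measure.ae_smul_measure ?_ _
  rw [ae_restrict_iff' (isClosed_stdSimplex ℝ (Fin (k + 1))).measurableSet]
  filter_upwards [compl_mem_ae_iff.2 hnull] with w hw hmem h0
  exact hw ⟨Fin.tail w, by simpa [hQ, hchart w hmem.2] using h0, hchart w hmem.2⟩

/-- The linear form with coefficients `a`. -/
noncomputable def linForm {k : ℕ} (a : Fin k → ℝ) : MvPolynomial (Fin k) ℝ :=
  ∑ i, C (a i) * X i

@[simp]
theorem eval_linForm {k : ℕ} (a v : Fin k → ℝ) : eval v (linForm a) = ∑ i, a i * v i := by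
  simp [linForm]

theorem eval_smul_linForm {k : ℕ} (a v : Fin k → ℝ) (t : ℝ) :
    eval (t • v) (linForm a) = t * eval v (linForm a) := by
  simp [Finset.mul_sum, mul_left_comm]

theorem prime_linForm {k : ℕ} {a : Fin k → ℝ} (ha : a ≠ 0) : Prime (linForm a) := by
  classical
  have h : linForm a = sumSMulX (Finsupp.equivFunOnFinite.symm a) := by
    simp [sumSMulX, Finsupp.linearCombination_apply, Finsupp.sum_fintype, linForm,
      smul_eq_C_mul]
  obtain ⟨i, hi⟩ := Function.ne_iff.1 ha
  rw [h]
  refine (irreducible_sumSMulX (Finsupp.equivFunOnFinite.symm a) ⟨i, by simpa using hi⟩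
    fun r hr => ?_).prime
  exact isUnit_of_dvd_unit (hr i) (by simpa using hi)

theorem cross_eq_of_linForm_dvd {k : ℕ} {a b : Fin k → ℝ} (h : linForm a ∣ linForm b)
    (i j : Fin k) : a i * b j = a j * b i := by
  obtain ⟨q, hq⟩ := h
  have := congrArg (eval (a i • Pi.single j 1 - a j • Pi.single i 1)) hq
  simp [mul_sub, Pi.single_apply, Finset.sum_sub_distrib] at this
  have h2 : b j * a i - b i * a j = 0 := by
    rw [this]; ring
  linarith

/-- The numerator of `∑ y, b y / a y` for linear forms `b y` and `a y`. -/
noncomputable def fractionNumerator {k m : ℕ} (a b : Fin m → Fin k → ℝ) :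
    MvPolynomial (Fin k) ℝ :=
  ∑ y, linForm (b y) * ∏ y' ∈ Finset.univ.erase y, linForm (a y')

theorem eval_smul_fractionNumerator {k m : ℕ} (a b : Fin m → Fin k → ℝ) (t : ℝ)
    (v : Fin k → ℝ) :
    eval (t • v) (fractionNumerator a b) = t ^ m * eval v (fractionNumerator a b) := by
  simp only [fractionNumerator, map_sum, map_mul, map_prod, eval_smul_linForm, Finset.mul_sum,
    Finset.prod_mul_distrib, Finset.prod_const]
  refine Finset.sum_congr rfl fun y _ => ?_
  have hm : t ^ m = t * t ^ (Finset.univ.erase y).card := by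
    rw [← pow_succ', Finset.card_erase_add_one (Finset.mem_univ y), Finset.card_univ,
      Fintype.card_fin]
  rw [hm]
  ring

theorem linForm_dvd_of_fractionNumerator_eq_zero {k m : ℕ} {a b : Fin m → Fin k → ℝ}
    (ha : ∀ y, a y ≠ 0)
    (hcross : ∀ y y', y ≠ y' → ∃ i j, a y i * a y' j ≠ a y j * a y' i)
    (h : fractionNumerator a b = 0) (y : Fin m) : linForm (a y) ∣ linForm (b y) := by
  have hp := prime_linForm (ha y)
  have hdvd : linForm (a y) ∣ linForm (b y) * ∏ y' ∈ Finset.univ.erase y, linForm (a y') := by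
    rw [fractionNumerator, ← Finset.add_sum_erase _ _ (Finset.mem_univ y)] at h
    rw [eq_neg_of_add_eq_zero_left h, dvd_neg]
    refine Finset.dvd_sum fun z hz => Dvd.dvd.mul_left ?_ _
    exact Finset.dvd_prod_of_mem _
      (Finset.mem_erase.2 ⟨(Finset.ne_of_mem_erase hz).symm, Finset.mem_univ y⟩)
  refine (hp.dvd_or_dvd hdvd).resolve_right fun h' => ?_
  obtain ⟨z, hz, hyz⟩ := (hp.dvd_finsetProd_iff _).1 h'
  obtain ⟨i, j, hij⟩ := hcross y z (Finset.ne_of_mem_erase hz).symm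
  exact hij (cross_eq_of_linForm_dvd hyz i j)

theorem eval_fractionNumerator {k m : ℕ} {a b : Fin m → Fin k → ℝ} {v : Fin k → ℝ}
    (hv : ∀ y, ∑ i, a y i * v i ≠ 0) :
    eval v (fractionNumerator a b) =
      (∏ y, ∑ i, a y i * v i) * ∑ y, (∑ i, b y i * v i) / ∑ i, a y i * v i := by
  simp only [fractionNumerator, map_sum, map_mul, map_prod, eval_linForm, Finset.mul_sum]
  refine Finset.sum_congr rfl fun y _ => ?_
  rw [← Finset.mul_prod_erase _ _ (Finset.mem_univ y)]
  field_simp [hv y]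

/-- Fewer than `n (n - 1)` selections of one entry per column have a common annihilator that is
not constant on columns. -/
theorem exists_annihilator {n : ℕ} (S : Finset (Fin n → Fin n)) (hS : S.card < n * (n - 1)) :
    ∃ u : Fin n → Fin n → ℝ, (∀ h ∈ S, ∑ y, u y (h y) = 0) ∧
      ¬ ∃ c : Fin n → ℝ, ∀ y x, u y x = c y := by
  let Φ : (Fin n → Fin n → ℝ) →ₗ[ℝ] (S → ℝ) :=
    { toFun := fun u h => ∑ y, u y (h.1 y)
      map_add' := fun u v => by funext h; simp [Finset.sum_add_distrib]
      map_smul' := fun r u => by funext h; simp [Finset.mul_sum] }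
  let Ψ : (Fin n → ℝ) →ₗ[ℝ] (Fin n → Fin n → ℝ) :=
    { toFun := fun c y _ => c y
      map_add' := fun _ _ => rfl
      map_smul' := fun _ _ => rfl }
  by_contra! hcon
  have hle : LinearMap.ker Φ ≤ LinearMap.range Ψ := by
    intro u hu
    obtain ⟨c, hc⟩ := hcon u fun h hh => congrFun (LinearMap.mem_ker.1 hu) ⟨h, hh⟩
    exact ⟨c, by funext y x; exact (hc y x).symm⟩
  have h1 := Submodule.finrank_mono hle
  have h2 := LinearMap.finrank_range_add_finrank_ker Φ
  have h3 := LinearMap.finrank_range_le Ψ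
  have h4 := Submodule.finrank_le (LinearMap.range Φ)
  simp only [Module.finrank_pi_fintype, Module.finrank_self, Finset.sum_const, Finset.card_univ,
    Fintype.card_fin, Fintype.card_coe, smul_eq_mul, mul_one] at h2 h3 h4
  have h5 : n * (n - 1) + n = n * n := by
    cases n with
    | zero => rfl
    | succ n => simp; ring
  omega

/-- The probability of `f(x, E) = y` when `E` has distribution `q`. -/
def response {n θ m : ℕ} (f : Fin n → Fin θ → Fin m) (q : Fin θ → ℝ) (x : Fin n) (y : Fin m) :
    ℝ :=
  ∑ e, if f x e = y then q e else 0

theorem continuous_response {n θ m : ℕ} (f : Fin n → Fin θ → Fin m) (x : Fin n) (y : Fin m) :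
    Continuous fun q => response f q x y := by
  refine continuous_finsetSum _ fun e _ => ?_
  split_ifs <;> fun_prop

theorem sum_response {n θ m : ℕ} (f : Fin n → Fin θ → Fin m) (q : Fin θ → ℝ) (x : Fin n) :
    ∑ y, response f q x y = ∑ e, q e := by
  simp only [response]
  rw [Finset.sum_comm]
  simp

theorem Generic.response_pos {n θ m : ℕ} {f : Fin n → Fin θ → Fin m} (hf : Generic f)
    {q : Fin θ → ℝ} (hq : ∀ e, 0 < q e) (x : Fin n) (y : Fin m) : 0 < response f q x y := by
  obtain ⟨e, he⟩ := hf.2 x y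
  refine Finset.sum_pos' (fun i _ => ?_) ⟨e, Finset.mem_univ e, by simp [he, hq e]⟩
  split_ifs
  exacts [(hq i).le, le_rfl]

theorem eval_linForm_indicator {n θ m : ℕ} (f : Fin n → Fin θ → Fin m) (q : Fin θ → ℝ)
    (x : Fin n) (y : Fin m) :
    eval q (linForm fun e => if f x e = y then 1 else 0) = response f q x y := by
  simp [response]

/-- The response vectors of two distinct outcomes are almost surely not proportional. -/
theorem Generic.ae_response_cross_ne {n θ m : ℕ} {f : Fin n → Fin θ → Fin m} (hf : Generic f)
    (hθ : 0 < θ) {x₁ x₂ : Fin n} (hx : x₁ ≠ x₂) {y y' : Fin m} (hy : y ≠ y') :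
    ∀ᵐ q ∂uniformSimplex θ,
      response f q x₁ y * response f q x₂ y' ≠ response f q x₂ y * response f q x₁ y' := by
  let I : Fin n → Fin m → Fin θ → ℝ := fun x y e => if f x e = y then 1 else 0
  have hsets : ∀ x z x' z', linForm (I x z) ∣ linForm (I x' z') →
      {e | f x e = z} = {e | f x' e = z'} := by
    intro x z x' z' h
    obtain ⟨i, hi⟩ := hf.2 x z
    obtain ⟨j, hj⟩ := hf.2 x' z'
    have hcross := cross_eq_of_linForm_dvd h i
    simp only [I, hi, if_true, one_mul] at hcross
    have hi' : f x' i = z' := by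
      by_contra hne
      have := hcross j
      simp [hj, hne] at this
    ext e
    have := hcross e
    simp only [hi', if_true, mul_one] at this
    by_cases h1 : f x e = z <;> by_cases h2 : f x' e = z' <;> simp_all
  have hne : I x₁ y ≠ 0 := by
    obtain ⟨i, hi⟩ := hf.2 x₁ y
    exact Function.ne_iff.2 ⟨i, by simp [I, hi]⟩
  have hP : linForm (I x₁ y) * linForm (I x₂ y') - linForm (I x₂ y) * linForm (I x₁ y') ≠ 0 := by
    intro h
    rcases (prime_linForm hne).dvd_or_dvd
      (Dvd.intro _ (sub_eq_zero.1 h)) with h | h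
    · exact hf.1 x₁ x₂ y hx (hsets _ _ _ _ h)
    · obtain ⟨i, hi⟩ := hf.2 x₁ y
      have hi' : i ∈ {e | f x₁ e = y'} := hsets _ _ _ _ h ▸ hi
      exact hy (hi.symm.trans hi')
  filter_upwards [ae_uniformSimplex_eval_ne_zero (d := 2) hθ hP fun t v => by
    simp only [map_sub, map_mul, eval_smul_linForm]; ring] with q hq
  simpa only [map_sub, map_mul, I, eval_linForm_indicator, sub_ne_zero] using hq

theorem ae_uniformSimplex_pos {k : ℕ} (hk : 0 < k) : ∀ᵐ w ∂uniformSimplex k, ∀ i, 0 < w i := by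
  rw [ae_all_iff]
  intro i
  filter_upwards [ae_uniformSimplex_mem k, ae_uniformSimplex_eval_ne_zero (d := 1) hk
    (X_ne_zero i) fun t v => by simp] with w hw hne
  exact lt_of_le_of_ne (hw.1 i) (Ne.symm (by simpa using hne))

/-- Every joint distribution with positive marginals is induced by some causal model. -/
theorem exists_isCausalModel {α β : Type*} [Fintype α] [Fintype β] [DecidableEq β]
    (p : α → β → ℝ) (hp : ∀ x y, 0 ≤ p x y) (hsum : ∀ x, ∑ y, p x y ≠ 0) :
    ∃ (m : ℕ) (pE : Fin m → ℝ) (f : α → Fin m → β), IsCausalModel p pE f := by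
  classical
  let r : α → β → ℝ := fun x y => p x y / ∑ y', p x y'
  have hr : ∀ x, ∑ y, r x y = 1 := fun x => by
    simp only [r, ← Finset.sum_div, div_self (hsum x)]
  let φ := (Fintype.equivFin (α → β)).symm
  refine ⟨Fintype.card (α → β), fun e => ∏ x, r x (φ e x), fun x e => φ e x, fun e => ?_, ?_,
    fun x y => ?_⟩
  · exact Finset.prod_nonneg fun x _ => div_nonneg (hp _ _) (Finset.sum_nonneg fun _ _ => hp _ _)
  · rw [Equiv.sum_comp φ fun h => ∏ x, r x (h x), ← Fintype.prod_sum]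
    simp [hr]
  · rw [Equiv.sum_comp φ fun h => if h x = y then ∏ x, r x (h x) else 0]
    have hterm : ∀ h : α → β, (if h x = y then ∏ x, r x (h x) else 0) =
        ∏ x', r x' (h x') * if x' = x then (if h x' = y then 1 else 0) else 1 := by
      intro h
      rw [Finset.prod_mul_distrib, Finset.prod_ite_eq' Finset.univ x]
      simp
    rw [Finset.sum_congr rfl fun h _ => hterm h,
      ← Fintype.prod_sum fun x' z => r x' z * if x' = x then (if z = y then 1 else 0) else 1,
      Finset.prod_eq_single x]
    · simp [r, mul_div_cancel₀ _ (hsum x)]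
    · intro x' _ hx'
      simp [hx', hr]
    · simp

theorem minExogenousSupportCard_le {α β : Type*} [Fintype α] [Fintype β] [DecidableEq β]
    {p : α → β → ℝ} {m : ℕ} {pE : Fin m → ℝ} {f : α → Fin m → β} (h : IsCausalModel p pE f) :
    minExogenousSupportCard p ≤ m := by
  have hle : minExogenousSupportCard p ≤ (Finset.univ.filter fun e => pE e ≠ 0).card :=
    Nat.sInf_le ⟨m, pE, f, h, rfl⟩
  exact hle.trans ((Finset.card_le_univ _).trans_eq (Fintype.card_fin m))

/-- If an exogenous variable only selects the functions in `S`, then every annihilator of `S`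
annihilates the conditional distributions. -/
theorem sum_div_eq_zero_of_isCausalModel {α β γ : Type*} [Fintype α] [Fintype β] [Fintype γ]
    [DecidableEq β] {p : α → β → ℝ} {q : γ → ℝ} {g : α → γ → β} (hg : IsCausalModel p q g)
    (hsum : ∀ x, ∑ y, p x y ≠ 0) {u : α → β → ℝ}
    (hu : ∀ e, q e ≠ 0 → ∑ x, u x (g x e) = 0) :
    ∑ x, (∑ y, u x y * p x y) / ∑ y, p x y = 0 := by
  have h1 : ∀ x, (∑ y, u x y * p x y) / ∑ y, p x y = ∑ e, u x (g x e) * q e := by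
    intro x
    rw [div_eq_iff (hsum x)]
    calc ∑ y, u x y * p x y
        = ∑ y, u x y * ((∑ y', p x y') * ∑ e, if g x e = y then q e else 0) :=
          Finset.sum_congr rfl fun y _ => by rw [← hg.2.2 x y]
      _ = ∑ y, ∑ e, if g x e = y then u x y * q e * ∑ y', p x y' else 0 := by
          refine Finset.sum_congr rfl fun y _ => ?_
          rw [Finset.mul_sum, Finset.mul_sum]
          refine Finset.sum_congr rfl fun e _ => ?_
          split_ifs <;> ring
      _ = (∑ e, u x (g x e) * q e) * ∑ y', p x y' := by
          rw [Finset.sum_comm, Finset.sum_mul]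
          simp
  simp only [h1]
  rw [Finset.sum_comm]
  refine Finset.sum_eq_zero fun e _ => ?_
  rw [← Finset.sum_mul]
  by_cases he : q e = 0
  · simp [he]
  · rw [hu e he, zero_mul]

/-- The numerator of the relation with coefficients `u` between the conditional distributions of
`X` given `Y`, as a form in the distribution of `X`. -/
noncomputable def relationNumerator {n θ m : ℕ} (f : Fin n → Fin θ → Fin m) (q : Fin θ → ℝ)
    (u : Fin m → Fin n → ℝ) : MvPolynomial (Fin n) ℝ :=
  fractionNumerator (fun y x => response f q x y) fun y x => u y x * response f q x y

theorem measurableSet_eval_relationNumerator_ne_zero {n θ m : ℕ} (f : Fin n → Fin θ → Fin m)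
    (u : Fin m → Fin n → ℝ) :
    MeasurableSet {w : (Fin n → ℝ) × (Fin θ → ℝ) | eval w.1 (relationNumerator f w.2 u) ≠ 0} := by
  refine (isClosed_singleton.preimage (f := fun w : (Fin n → ℝ) × (Fin θ → ℝ) =>
    eval w.1 (relationNumerator f w.2 u)) ?_).measurableSet.compl
  have h : ∀ x y, Continuous fun w : (Fin n → ℝ) × (Fin θ → ℝ) => response f w.2 x y :=
    fun x y => (continuous_response f x y).comp continuous_snd
  simp only [relationNumerator, fractionNumerator, map_sum, map_mul, map_prod, eval_linForm]
  fun_prop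

/-- A relation that is not constant on columns almost surely fails. -/
theorem Generic.ae_eval_relationNumerator_ne_zero {n θ m : ℕ} {f : Fin n → Fin θ → Fin m}
    (hf : Generic f) (hn : 1 < n) (hθ : 0 < θ) {u : Fin m → Fin n → ℝ}
    (hu : ¬ ∃ c : Fin m → ℝ, ∀ y x, u y x = c y) :
    ∀ᵐ w ∂((uniformSimplex n).prod (uniformSimplex θ)),
      eval w.1 (relationNumerator f w.2 u) ≠ 0 := by
  have hmeas := measurableSet_eval_relationNumerator_ne_zero f u
  rw [Measure.ae_prod_iff_ae_ae hmeas,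
    Measure.ae_ae_comm (p := fun w q => eval w (relationNumerator f q u) ≠ 0) hmeas]
  let x₁ : Fin n := ⟨0, by omega⟩
  let x₂ : Fin n := ⟨1, hn⟩
  have hx : x₁ ≠ x₂ := by simp [x₁, x₂]
  have hcross : ∀ᵐ q ∂uniformSimplex θ, ∀ y y', y ≠ y' →
      response f q x₁ y * response f q x₂ y' ≠ response f q x₂ y * response f q x₁ y' := by
    simp only [ae_all_iff]
    exact fun y y' hy => hf.ae_response_cross_ne hθ hx hy
  filter_upwards [hcross, ae_uniformSimplex_pos hθ] with q hq hpos
  have hresp := hf.response_pos hpos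
  refine ae_uniformSimplex_eval_ne_zero (by omega) (fun h => hu ?_)
    (eval_smul_fractionNumerator _ _)
  have hdvd := linForm_dvd_of_fractionNumerator_eq_zero
    (fun y => Function.ne_iff.2 ⟨x₁, (hresp x₁ y).ne'⟩)
    (fun y y' hy => ⟨x₁, x₂, hq y y' hy⟩) h
  refine ⟨fun y => u y x₁, fun y x => ?_⟩
  have hc := cross_eq_of_linForm_dvd (hdvd y) x₁ x
  have h1 := (hresp x₁ y).ne'
  have h2 := (hresp x y).ne'
  refine mul_left_cancel₀ (mul_ne_zero h1 h2) ?_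
  linear_combination hc

/-- **Identification of the causal direction by minimum cardinality.**
Consider the causal model `X → Y` with `Y = f₀(X, E₀)` where `X, Y` have `n` states,
`E₀ ⟂ X` has `θ < n(n-1)` states, `f₀` is generic, and the distributions of `X` and `E₀`
are drawn uniformly and independently from the `(n-1)`- and `(θ-1)`-dimensional
probability simplices.  Then with probability `1` the minimum support cardinality of an
exogenous variable `E ⟂ X` with `Y = f(X,E)` is strictly smaller than the minimum support
cardinality of an exogenous variable `Ẽ ⟂ Y` with `X = g(Y,Ẽ)` (both models inducing the
observed joint distribution); hence comparing these minima identifies the true causal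
direction. -/
theorem min_card_identifies_direction_ae
    (n θ : ℕ) (hn : 0 < n) (hθpos : 0 < θ) (hθ : θ < n * (n - 1))
    (f₀ : Fin n → Fin θ → Fin n) (hf₀ : Generic f₀) :
    ∀ᵐ w ∂((uniformSimplex n).prod (uniformSimplex θ)),
      minExogenousSupportCard (jointOf w.1 w.2 f₀) <
        minExogenousSupportCard (fun y x => jointOf w.1 w.2 f₀ x y) := by
  have hn1 : 1 < n := by
    by_contra h
    interval_cases n
    omega
  choose u hu hu' using fun S : {S : Finset (Fin n → Fin n) // S.card < n * (n - 1)} =>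
    exists_annihilator S.1 S.2
  have hrel : ∀ᵐ w ∂((uniformSimplex n).prod (uniformSimplex θ)),
      ∀ S, eval w.1 (relationNumerator f₀ w.2 (u S)) ≠ 0 :=
    ae_all_iff.2 fun S => hf₀.ae_eval_relationNumerator_ne_zero hn1 hθpos (hu' S)
  filter_upwards [hrel, Measure.quasiMeasurePreserving_fst.ae (ae_uniformSimplex_pos hn),
    Measure.quasiMeasurePreserving_snd.ae (ae_uniformSimplex_pos hθpos),
    Measure.quasiMeasurePreserving_snd.ae (ae_uniformSimplex_mem θ)]
    with w hw hX hE hEmem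
  have hresp := hf₀.response_pos hE
  have hjoint : ∀ x y, jointOf w.1 w.2 f₀ x y = w.1 x * response f₀ w.2 x y := fun _ _ => rfl
  have hpos : ∀ x y, 0 < jointOf w.1 w.2 f₀ x y := fun x y => mul_pos (hX x) (hresp x y)
  have hmarg : ∀ y, ∑ x, jointOf w.1 w.2 f₀ x y ≠ 0 := fun y =>
    (Finset.sum_pos (fun x _ => hpos x y) ⟨⟨0, hn⟩, Finset.mem_univ _⟩).ne'
  have hforward : IsCausalModel (jointOf w.1 w.2 f₀) w.2 f₀ := by
    refine ⟨hEmem.1, hEmem.2, fun x y => ?_⟩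
    simp only [hjoint, ← Finset.mul_sum, sum_response, hEmem.2, mul_one]
    rfl
  refine (minExogenousSupportCard_le hforward).trans_lt (hθ.trans_le ?_)
  obtain ⟨m₀, q₀, g₀, h₀⟩ := exists_isCausalModel (fun y x => jointOf w.1 w.2 f₀ x y)
    (fun y x => (hpos x y).le) hmarg
  refine le_csInf ⟨_, m₀, q₀, g₀, h₀, rfl⟩ ?_
  rintro _ ⟨m, q, g, hg, rfl⟩
  by_contra! hlt
  let S : Finset (Fin n → Fin n) :=
    (Finset.univ.filter fun e => q e ≠ 0).image fun e y => g y e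
  have hS : S.card < n * (n - 1) := Finset.card_image_le.trans_lt hlt
  refine hw ⟨S, hS⟩ ?_
  have hzero := sum_div_eq_zero_of_isCausalModel hg hmarg (u := u ⟨S, hS⟩) fun e he =>
    hu ⟨S, hS⟩ (fun y => g y e) (Finset.mem_image_of_mem _ (by simpa using he))
  have hden : ∀ y, ∑ x, response f₀ w.2 x y * w.1 x = ∑ x, jointOf w.1 w.2 f₀ x y := fun y =>
    Finset.sum_congr rfl fun x _ => mul_comm _ _
  rw [relationNumerator, eval_fractionNumerator fun y => by rw [hden]; exact hmarg y]
  refine mul_eq_zero_of_right _ (Eq.trans (Finset.sum_congr rfl fun y _ => ?_) hzero)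
  rw [hden]
  congr 1
  refine Finset.sum_congr rfl fun x _ => ?_
  rw [hjoint]
  ring
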